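/- arXiv:0708.0962 — 9 statements merged into one kernel-verified Lean document; each statement's English description precedes it below -/
import Mathlib

section
/- For every Q ∈ Y⁰ the following hold: (1) if π₁(Q) is canonical then ν_Y(π₂(Q)) = ν_Y(π₁(Q))/e; (2) if π₁(Q) is too singular then ν_Y(π₂(Q)) = 1/(e+1); (3) if π₁(Q) is anti-canonical then either ν_Y(π₂(Q)) = 1 − ν_Y(π₁(Q)) or ν_Y(π₂(Q)) = 1 − e·(1 − ν_Y(π₁(Q))). Moreover, for all real s, t ∈ (e/(e+1), 1] one has 1 − s < 1/(e+1) < 1 − e·(1 − t), so the two alternatives in (3) never coincide. (Lemma 2.5 of the paper, stated in the abstract setting of the measures of singularity.) -/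
/-- Lemma 2.5 of the paper, stated in the abstract setting of the measures of
singularity, with the correspondence data `π₁, π₁′ : Y0 → Y`, `π₂ := w ∘ π₁′`. -/
theorem pi2_position
    (X Y Y0 : Type*) (π : Y → X) (w : Y → Y) (νY : Y → ℝ) (νX : X → ℝ)
    (e : ℝ) (he : 1 < e)
    (hbound : ∀ Q : Y, 0 ≤ νY Q ∧ νY Q ≤ 1)
    (hcan : ∀ Q : Y, νY Q < e / (e + 1) → νX (π Q) = νY Q)
    (hanti : ∀ Q : Y, e / (e + 1) < νY Q → νX (π Q) = e * (1 - νY Q))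
    (hsing : ∀ Q : Y, νY Q = e / (e + 1) → e / (e + 1) ≤ νX (π Q))
    (hw : ∀ Q : Y, νY (w Q) = 1 - νY Q)
    (π₁ π₁' π₂ : Y0 → Y)
    (hcompat : ∀ Q : Y0, π (π₁ Q) = π (π₁' Q))
    (hπ₂ : ∀ Q : Y0, π₂ Q = w (π₁' Q))
    (hA5 : ∀ Q : Y0,
      (νY (π₁ Q) < e / (e + 1) → e / (e + 1) < νY (π₁' Q)) ∧
      (νY (π₁' Q) < e / (e + 1) → e / (e + 1) < νY (π₁ Q))) :
    (∀ Q : Y0,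
      (νY (π₁ Q) < e / (e + 1) → νY (π₂ Q) = νY (π₁ Q) / e) ∧
      (νY (π₁ Q) = e / (e + 1) → νY (π₂ Q) = 1 / (e + 1)) ∧
      (e / (e + 1) < νY (π₁ Q) →
        νY (π₂ Q) = 1 - νY (π₁ Q) ∨ νY (π₂ Q) = 1 - e * (1 - νY (π₁ Q)))) ∧
    (∀ s t : ℝ, s ∈ Set.Ioc (e / (e + 1)) 1 → t ∈ Set.Ioc (e / (e + 1)) 1 →
      1 - s < 1 / (e + 1) ∧ 1 / (e + 1) < 1 - e * (1 - t)) := by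
  have he0 : 0 < e := by linarith
  have h1 : 1 / (e + 1) = 1 - e / (e + 1) := by
    field_simp
    ring
  have h2 : e * (1 - e / (e + 1)) = e / (e + 1) := by
    field_simp
    ring
  rw [h1]
  generalize e / (e + 1) = c at *
  have key : ∀ t, c < t → e * (1 - t) < c := by
    intro t ht
    have := mul_lt_mul_of_pos_left ht he0
    linarith
  refine ⟨fun Q => ?_, fun s t hs ht => ⟨by linarith [hs.1], by linarith [key t ht.1]⟩⟩
  have hc := hcompat Q
  obtain ⟨hA, hB⟩ := hA5 Q
  rw [hπ₂ Q, hw]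
  refine ⟨fun h => ?_, fun h => ?_, fun h => ?_⟩
  · have ha := hcan _ h
    have hb := hanti _ (hA h)
    rw [hc, hb] at ha
    rw [eq_div_iff he0.ne']
    linarith
  · have ha := hsing _ h
    rcases lt_trichotomy (νY (π₁' Q)) c with h' | h' | h'
    · linarith [hB h']
    · rw [h']
    · have hb := hanti _ h'
      rw [hc, hb] at ha
      linarith [key _ h']
  · have ha := hanti _ h
    rcases lt_trichotomy (νY (π₁' Q)) c with h' | h' | h'
    · have hb := hcan _ h'
      rw [hc, hb] at ha
      right
      rw [ha]
    · have hb := hsing _ h'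
      rw [← hc, ha] at hb
      linarith [key _ h]
    · have hb := hanti _ h'
      rw [hc, hb] at ha
      left
      exact mul_left_cancel₀ he0.ne' ha
end

section
/- For every set I ⊆ (e/(e+1), 1], the image of {Q ∈ Y : ν_Y(Q) ∈ I} under s⁰ equals {R ∈ Y⁰ : ν_Y(π₂(R)) ∈ I^τ and ν_Y(π₁(R)) ∈ I}, where I^τ := {1 − e·(1−t) : t ∈ I}. In particular s⁰({Q ∈ Y : ν_Y(Q) ∈ I}) ⊆ {R ∈ Y⁰ : ν_Y(π₂(R)) ∈ I^τ}. (Corollary 2.6 of the paper, stated in the abstract setting of the measures of singularity.) -/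
/-- Corollary 2.6 of the paper, stated in the abstract setting of the measures
of singularity: for every `I ⊆ (e/(e+1), 1]`,
`s⁰ '' {Q | ν_Y Q ∈ I} = {R | ν_Y (π₂ R) ∈ I^τ ∧ ν_Y (π₁ R) ∈ I}`,
where `I^τ = {1 - e·(1-t) : t ∈ I}`; in particular the left-hand side is
contained in `{R | ν_Y (π₂ R) ∈ I^τ}`. -/
theorem section_image
    (X Y Y0 : Type*) (π : Y → X) (w : Y → Y) (νY : Y → ℝ) (νX : X → ℝ)
    (e : ℝ) (he : 1 < e)
    (hbound : ∀ Q : Y, 0 ≤ νY Q ∧ νY Q ≤ 1)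
    (hcan : ∀ Q : Y, νY Q < e / (e + 1) → νX (π Q) = νY Q)
    (hanti : ∀ Q : Y, e / (e + 1) < νY Q → νX (π Q) = e * (1 - νY Q))
    (hsing : ∀ Q : Y, νY Q = e / (e + 1) → e / (e + 1) ≤ νX (π Q))
    (hw : ∀ Q : Y, νY (w Q) = 1 - νY Q)
    (π₁ π₁' π₂ : Y0 → Y)
    (hcompat : ∀ Q : Y0, π (π₁ Q) = π (π₁' Q))
    (hπ₂ : ∀ Q : Y0, π₂ Q = w (π₁' Q))
    (hA5 : ∀ Q : Y0,
      (νY (π₁ Q) < e / (e + 1) → e / (e + 1) < νY (π₁' Q)) ∧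
      (νY (π₁' Q) < e / (e + 1) → e / (e + 1) < νY (π₁ Q)))
    (s0 : Y → Y0)
    (hsec : ∀ Q : Y, e / (e + 1) < νY Q → π₁ (s0 Q) = Q)
    (himage : s0 '' {Q : Y | e / (e + 1) < νY Q} =
      {R : Y0 | νY (π₁' R) < e / (e + 1)}) :
    ∀ I : Set ℝ, I ⊆ Set.Ioc (e / (e + 1)) 1 →
      (s0 '' {Q : Y | νY Q ∈ I} =
        {R : Y0 | νY (π₂ R) ∈ (fun t : ℝ => 1 - e * (1 - t)) '' I ∧
          νY (π₁ R) ∈ I}) ∧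
      (s0 '' {Q : Y | νY Q ∈ I} ⊆
        {R : Y0 | νY (π₂ R) ∈ (fun t : ℝ => 1 - e * (1 - t)) '' I}) := by
  intro I hI
  have hc : e * (1 - e / (e + 1)) = e / (e + 1) := by
    have : e + 1 ≠ 0 := by linarith
    field_simp
    ring
  have hfwd : ∀ Q : Y, νY Q ∈ I → νY (π₂ (s0 Q)) = 1 - e * (1 - νY Q) := by
    intro Q hQ
    have h1 := (hI hQ).1
    have h2 : s0 Q ∈ {R : Y0 | νY (π₁' R) < e / (e + 1)} := by
      rw [← himage]
      exact ⟨Q, h1, rfl⟩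
    have h3 := hcan _ h2
    rw [← hcompat, hsec Q h1, hanti Q h1] at h3
    rw [hπ₂, hw, ← h3]
  have heq : s0 '' {Q : Y | νY Q ∈ I} =
        {R : Y0 | νY (π₂ R) ∈ (fun t : ℝ => 1 - e * (1 - t)) '' I ∧
          νY (π₁ R) ∈ I} := by
    ext R
    constructor
    · rintro ⟨Q, hQ, rfl⟩
      refine ⟨⟨νY Q, hQ, (hfwd Q hQ).symm⟩, ?_⟩
      rw [hsec Q (hI hQ).1]
      exact hQ
    · rintro ⟨⟨t, ht, h⟩, h1⟩
      have ht1 := (hI ht).1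
      simp only [hπ₂, hw] at h
      have h2 : R ∈ {R : Y0 | νY (π₁' R) < e / (e + 1)} := by
        have := mul_lt_mul_of_pos_left ht1 (by linarith : 0 < e)
        simp only [Set.mem_setOf_eq]
        linarith
      rw [← himage] at h2
      obtain ⟨Q, hQ, rfl⟩ := h2
      rw [hsec Q hQ] at h1
      exact ⟨Q, h1, rfl⟩
  exact ⟨heq, fun R hR => (heq ▸ hR : R ∈ {R : Y0 | νY (π₂ R) ∈ (fun t : ℝ => 1 - e * (1 - t)) '' I ∧
          νY (π₁ R) ∈ I}).1⟩
end

section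
/- For every polynomial A ∈ L[X] with A(0) ≠ 0, every f₀ ∈ M₀, and every compatible family F = (F_n)_{n≥0} ∈ M_∞ such that A(U₀)(f₀) = F₀, there exists a compatible family f = (f_n)_{n≥0} ∈ M_∞ whose 0-th component is f₀ and which satisfies A(U_∞)(f) = F. (Proposition 3.1(1) of the paper: an overconvergent section f₀ with A(U₀)f₀ extendable to the whole increasing cover extends itself, and the extension satisfies A(U_∞)f = F.) -/
/-- Proposition 3.1(1) of the paper, in the abstract tower setting: given the
tower `(M n)` with restrictions `r n : M (n+1) → M n`, traces
`T n : M n → M (n+1)` satisfying `r (n+1) ∘ T (n+1) = T n ∘ r n`, and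
`U n := c • (r n ∘ T n)`, if `A ∈ L[X]` has `A(0) ≠ 0`, `F = (F n)` is a
compatible family and `f₀ ∈ M 0` satisfies `A(U 0) f₀ = F 0`, then there is a
compatible family `f` with `f 0 = f₀` and `A(U n) (f n) = F n` for all `n`. -/
theorem analytic_continuation_tower
    (L : Type*) [Field L] (c : L)
    (M : ℕ → Type*) [∀ n, AddCommGroup (M n)] [∀ n, Module L (M n)]
    (r : ∀ n : ℕ, M (n + 1) →ₗ[L] M n)
    (T : ∀ n : ℕ, M n →ₗ[L] M (n + 1))
    (hcomp : ∀ n : ℕ, (r (n + 1)) ∘ₗ (T (n + 1)) = (T n) ∘ₗ (r n))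
    (U : ∀ n : ℕ, Module.End L (M n))
    (hU : ∀ n : ℕ, U n = c • ((r n) ∘ₗ (T n)))
    (A : Polynomial L) (hA : Polynomial.eval 0 A ≠ 0)
    (F : ∀ n : ℕ, M n) (hF : ∀ n : ℕ, r n (F (n + 1)) = F n)
    (f₀ : M 0) (h₀ : Polynomial.aeval (U 0) A f₀ = F 0) :
    ∃ f : ∀ n : ℕ, M n,
      (∀ n : ℕ, r n (f (n + 1)) = f n) ∧ f 0 = f₀ ∧
      ∀ n : ℕ, Polynomial.aeval (U n) A (f n) = F n := by
  have hU' : ∀ n (x : M n), U n x = c • r n (T n x) := fun n x => by rw [hU n]; rfl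
  have hc : ∀ n (x : M (n + 1)), r (n + 1) (T (n + 1) x) = T n (r n x) := fun n x =>
    LinearMap.congr_fun (hcomp n) x
  have hB : ∀ (B : Polynomial L) n (x : M (n + 1)),
      r n (Polynomial.aeval (U (n + 1)) B x) = Polynomial.aeval (U n) B (r n x) := by
    intro B n
    induction B using Polynomial.induction_on' with
    | add p q hp hq => intro x; simp [hp, hq]
    | monomial k a =>
      intro x
      have hk : ∀ (k : ℕ) (y : M (n + 1)), r n ((U (n + 1) ^ k) y) = (U n ^ k) (r n y) := by
        intro k
        induction k with
        | zero => intro y; simp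
        | succ k ih =>
          intro y
          rw [pow_succ, pow_succ, Module.End.mul_apply, Module.End.mul_apply, ih, hU', hU', hc,
            map_smul]
      simp [Polynomial.aeval_monomial, Module.End.mul_apply, hk, Module.algebraMap_end_apply]
  obtain ⟨a, ha⟩ : ∃ a, a = Polynomial.eval 0 A := ⟨_, rfl⟩
  rw [← ha] at hA
  obtain ⟨B, hAB⟩ : ∃ B : Polynomial L, A = Polynomial.X * B + Polynomial.C a :=
    ⟨A.divX, by rw [ha, ← Polynomial.coeff_zero_eq_eval_zero, Polynomial.X_mul_divX_add]⟩
  have hAx : ∀ n (x : M n), Polynomial.aeval (U n) A x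
      = c • r n (T n (Polynomial.aeval (U n) B x)) + a • x := by
    intro n x
    rw [hAB, map_add, map_mul, Polynomial.aeval_X, Polynomial.aeval_C, LinearMap.add_apply,
      Module.End.mul_apply, hU', Module.algebraMap_end_apply]
  let f : ∀ n, M n := fun n => Nat.rec (motive := fun n => M n) f₀
    (fun n x => a⁻¹ • (F (n + 1) - c • T n (Polynomial.aeval (U n) B x))) n
  have hf : ∀ n, f (n + 1) = a⁻¹ • (F (n + 1) - c • T n (Polynomial.aeval (U n) B (f n))) :=
    fun n => rfl
  have hr : ∀ n, Polynomial.aeval (U n) A (f n) = F n → r n (f (n + 1)) = f n := by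
    intro n h
    rw [hf, map_smul, map_sub, map_smul, hF, ← h, hAx, add_sub_cancel_left, inv_smul_smul₀ hA]
  have key : ∀ n, Polynomial.aeval (U n) A (f n) = F n := by
    intro n
    induction n with
    | zero => exact h₀
    | succ n ih =>
      rw [hAx, hc, hB, hr n ih, hf, smul_inv_smul₀ hA, add_sub_cancel]
  exact ⟨f, fun n => hr n (key n), rfl, key⟩
end

section
/- Let a ∈ L with a ≠ 0 and let N ≥ 1 be an integer. If f₀ ∈ M₀ satisfies (U₀ − a·id)^N(f₀) = 0 (i.e. f₀ is a generalized eigensection of U₀ with nonzero generalized eigenvalue a), then there exists a compatible family f = (f_n)_{n≥0} ∈ M_∞ whose 0-th component is f₀ and which satisfies (U_∞ − a·id)^N(f) = 0. (Proposition 3.1(2) of the paper.) -/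
theorem aux_surj {L V : Type*} [Field L] [AddCommGroup V] [Module L V] (U : Module.End L V)
    (a : L) (ha : a ≠ 0) (N : ℕ) : ∀ x : V, ((U - a • (1 : Module.End L V)) ^ N) x = 0 →
    ∃ y : V, ((U - a • (1 : Module.End L V)) ^ N) y = 0 ∧ U y = x := by
  induction N with
  | zero => intro x hx; exact ⟨0, by simp, by simpa using hx.symm⟩
  | succ N ih =>
    intro x hx
    have hx2 := hx
    rw [pow_succ, Module.End.mul_apply] at hx2
    obtain ⟨z, hz, hUz⟩ := ih _ hx2
    refine ⟨a⁻¹ • (x - z), ?_, ?_⟩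
    · rw [map_smul, map_sub, hx, pow_succ', Module.End.mul_apply, hz]
      simp
    · rw [map_smul, map_sub, hUz]
      simp [smul_smul, ha]

/-- Proposition 3.1(2) of the paper, in the abstract tower setting: a
generalized eigensection `f₀ ∈ M 0` of `U 0` with nonzero generalized
eigenvalue `a` (i.e. `(U 0 - a·id)^N f₀ = 0`) extends to a compatible family
`f` with `(U n - a·id)^N (f n) = 0` for all `n`. -/
theorem analytic_continuation_eigensection
    (L : Type*) [Field L] (c : L)
    (M : ℕ → Type*) [∀ n, AddCommGroup (M n)] [∀ n, Module L (M n)]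
    (r : ∀ n : ℕ, M (n + 1) →ₗ[L] M n)
    (T : ∀ n : ℕ, M n →ₗ[L] M (n + 1))
    (hcomp : ∀ n : ℕ, (r (n + 1)) ∘ₗ (T (n + 1)) = (T n) ∘ₗ (r n))
    (U : ∀ n : ℕ, Module.End L (M n))
    (hU : ∀ n : ℕ, U n = c • ((r n) ∘ₗ (T n)))
    (a : L) (ha : a ≠ 0) (N : ℕ) (hN : 1 ≤ N)
    (f₀ : M 0) (h₀ : ((U 0 - a • (1 : Module.End L (M 0))) ^ N) f₀ = 0) :
    ∃ f : ∀ n : ℕ, M n,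
      (∀ n : ℕ, r n (f (n + 1)) = f n) ∧ f 0 = f₀ ∧
      ∀ n : ℕ, ((U n - a • (1 : Module.End L (M n))) ^ N) (f n) = 0 := by
  have hT : ∀ n (k : ℕ) (x : M n), ((U (n+1) - a • (1 : Module.End L (M (n+1)))) ^ k) (T n x)
      = T n (((U n - a • (1 : Module.End L (M n))) ^ k) x) := by
    intro n k
    induction k with
    | zero => intro x; simp
    | succ k ih =>
      intro x
      rw [pow_succ, pow_succ, Module.End.mul_apply, Module.End.mul_apply, ← ih]
      congr 1
      rw [hU, hU, hcomp]
      simp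
  have step : ∀ n (x : M n), ((U n - a • (1 : Module.End L (M n))) ^ N) x = 0 →
      ∃ y : M (n+1), ((U (n+1) - a • (1 : Module.End L (M (n+1)))) ^ N) y = 0 ∧ r n y = x := by
    intro n x hx
    obtain ⟨y, hy, hUy⟩ := aux_surj (U n) a ha N x hx
    refine ⟨c • T n y, ?_, ?_⟩
    · rw [map_smul, hT, hy]; simp
    · rw [← hUy, hU]; simp
  choose g hg hr using step
  let F : ∀ n, {x : M n // ((U n - a • (1 : Module.End L (M n))) ^ N) x = 0} := fun n =>
    Nat.rec ⟨f₀, h₀⟩ (fun n x => ⟨g n x.1 x.2, hg n x.1 x.2⟩) n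
  exact ⟨fun n => (F n).1, fun n => hr n (F n).1 (F n).2, rfl, fun n => (F n).2⟩
end

section
/- Let A₀ ∈ L[X], let a ∈ L with a ≠ 0, and set A := X·A₀ − a ∈ L[X]. Let F = (F_n)_{n≥0} ∈ M_∞ and f₀ ∈ M₀ satisfy A(U₀)(f₀) = F₀. Define f_n ∈ M_n for n ≥ 1 recursively by f_n := a⁻¹·( c·T_n( A₀(U_{n-1})(f_{n-1}) ) − F_n ). Then for every n ≥ 1 one has A(U_n)(f_n) = F_n and r_{n-1}(f_n) = f_{n-1}. (The inductive claims P(n) and Q(n) established in the proof of Proposition 3.1 of the paper.) -/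
/-- The inductive claims P(n), Q(n) in the proof of Proposition 3.1 of the
paper: with `A = X·A₀ - a` and `f` defined recursively by
`f (n+1) = a⁻¹·(c·T_{n+1}(A₀(U n)(f n)) - F (n+1))`, one has
`A(U n)(f n) = F n` and `r n (f (n+1)) = f n` for all `n`. -/
theorem tower_recursion_PQ
    (L : Type*) [Field L] (c : L)
    (M : ℕ → Type*) [∀ n, AddCommGroup (M n)] [∀ n, Module L (M n)]
    (r : ∀ n : ℕ, M (n + 1) →ₗ[L] M n)
    (T : ∀ n : ℕ, M n →ₗ[L] M (n + 1))
    (hcomp : ∀ n : ℕ, (r (n + 1)) ∘ₗ (T (n + 1)) = (T n) ∘ₗ (r n))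
    (U : ∀ n : ℕ, Module.End L (M n))
    (hU : ∀ n : ℕ, U n = c • ((r n) ∘ₗ (T n)))
    (A₀ : Polynomial L) (a : L) (ha : a ≠ 0)
    (A : Polynomial L) (hA : A = Polynomial.X * A₀ - Polynomial.C a)
    (F : ∀ n : ℕ, M n) (hF : ∀ n : ℕ, r n (F (n + 1)) = F n)
    (f : ∀ n : ℕ, M n)
    (h₀ : Polynomial.aeval (U 0) A (f 0) = F 0)
    (hrec : ∀ n : ℕ,
      f (n + 1) = a⁻¹ • (c • T n (Polynomial.aeval (U n) A₀ (f n)) - F (n + 1))) :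
    ∀ n : ℕ,
      Polynomial.aeval (U (n + 1)) A (f (n + 1)) = F (n + 1) ∧
      r n (f (n + 1)) = f n := by
  have hU' : ∀ n x, U (n + 1) x = c • T n (r n x) := by
    intro n x
    rw [hU, hcomp]; rfl
  have hU0 : ∀ n x, U n x = c • r n (T n x) := by
    intro n x
    rw [hU]; rfl
  have hcm : ∀ n x, r n (U (n + 1) x) = U n (r n x) := by
    intro n x
    rw [hU', hU0, map_smul]
  have hpoly : ∀ n (p : Polynomial L) x,
      r n (Polynomial.aeval (U (n + 1)) p x) = Polynomial.aeval (U n) p (r n x) := by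
    intro n p
    induction p using Polynomial.induction_on' with
    | add p q hp hq => intro x; simp [hp, hq]
    | monomial k b =>
      have hk : ∀ x, r n ((U (n + 1) ^ k) x) = (U n ^ k) (r n x) := by
        induction k with
        | zero => intro x; simp
        | succ k ih => intro x; rw [pow_succ, pow_succ, Module.End.mul_apply, ih, hcm]; rfl
      intro x
      simp [Polynomial.aeval_monomial, Module.algebraMap_end_apply, hk]
  have hAe : ∀ n x, Polynomial.aeval (U n) A x
      = U n (Polynomial.aeval (U n) A₀ x) - a • x := by
    intro n x
    simp [hA, Module.algebraMap_end_apply]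
  have hQ : ∀ n, Polynomial.aeval (U n) A (f n) = F n → r n (f (n + 1)) = f n := by
    intro n h
    rw [hrec, map_smul, map_sub, map_smul, ← hU0, hF, ← h, hAe, sub_sub_cancel,
      inv_smul_smul₀ ha]
  have hP : ∀ n, Polynomial.aeval (U n) A (f n) = F n →
      Polynomial.aeval (U (n + 1)) A (f (n + 1)) = F (n + 1) := by
    intro n h
    rw [hAe, hU', hpoly, hQ n h, hrec n, smul_inv_smul₀ ha, sub_sub_cancel]
  have hall : ∀ n, Polynomial.aeval (U n) A (f n) = F n := by
    intro n
    induction n with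
    | zero => exact h₀
    | succ n ih => exact hP n ih
  exact fun n => ⟨hall (n + 1), hQ n (hall n)⟩
end

section
/- For every Q ∈ Z: if ν_Y(φ_{i+1}(Q)) < 1 then ν_Y(φ_i(Q)) < 1. (Lemma 3.3 of the paper: φ_{m}⁻¹(𝔜_rig[0,1)) ⊆ φ_{m-1}⁻¹(𝔜_rig[0,1)) ⊆ ⋯ ⊆ φ_1⁻¹(𝔜_rig[0,1)), stated in the abstract setting of the measures of singularity.) -/
/-- Lemma 3.3 of the paper, stated in the abstract setting: for every `Q ∈ Z`,
if `ν_Y (φ_{i+1} Q) < 1` then `ν_Y (φ_i Q) < 1`. -/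
theorem nested_ordinary_loci
    (X Y Y0 Z Z0 : Type*) (π : Y → X) (w : Y → Y) (νY : Y → ℝ) (νX : X → ℝ)
    (e : ℝ) (he : 1 < e)
    (hbound : ∀ Q : Y, 0 ≤ νY Q ∧ νY Q ≤ 1)
    (hcan : ∀ Q : Y, νY Q < e / (e + 1) → νX (π Q) = νY Q)
    (hanti : ∀ Q : Y, e / (e + 1) < νY Q → νX (π Q) = e * (1 - νY Q))
    (hsing : ∀ Q : Y, νY Q = e / (e + 1) → e / (e + 1) ≤ νX (π Q))
    (hw : ∀ Q : Y, νY (w Q) = 1 - νY Q)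
    (π₁ π₁' π₂ : Y0 → Y)
    (hcompat : ∀ Q : Y0, π (π₁ Q) = π (π₁' Q))
    (hπ₂ : ∀ Q : Y0, π₂ Q = w (π₁' Q))
    (hA5 : ∀ Q : Y0,
      (νY (π₁ Q) < e / (e + 1) → e / (e + 1) < νY (π₁' Q)) ∧
      (νY (π₁' Q) < e / (e + 1) → e / (e + 1) < νY (π₁ Q)))
    (δ : Y → Y) (hδ : ∀ Q : Y, νY (δ Q) = νY Q)
    (lam₁ : Z0 → Z) (hlam₁ : Function.Surjective lam₁)
    (φi φnext : Z → Y) (η : Z0 → Y0)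
    (hH31 : ∀ R : Z0, π₁ (η R) = φnext (lam₁ R))
    (hH32 : ∀ R : Z0, δ (π₂ (η R)) = φi (lam₁ R)) :
    ∀ Q : Z, νY (φnext Q) < 1 → νY (φi Q) < 1 := by
  intro Q hQ
  obtain ⟨R, rfl⟩ := hlam₁ Q
  rw [← hH31] at hQ
  rw [← hH32, hδ, hπ₂, hw]
  by_contra hcon
  have h0 : νY (π₁' (η R)) = 0 := by
    have := (hbound (π₁' (η R))).1
    linarith
  have hpos : 0 < e / (e + 1) := by positivity
  have hc : νY (π₁' (η R)) < e / (e + 1) := by rw [h0]; exact hpos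
  have h1 := hanti _ ((hA5 (η R)).2 hc)
  rw [hcompat, hcan _ hc, h0] at h1
  have h2 : 0 < e * (1 - νY (π₁ (η R))) := mul_pos (by linarith) (by linarith)
  linarith
end

section
/- For every integer n ≥ 0 and every Q ∈ Y⁰: if ν_Y(π₁(Q)) ≤ 1 − e^(−n)/(e+1), then ν_Y(π₂(Q)) ≤ 1 − e^(1−n)/(e+1). (The key covering inclusion π₁⁻¹(𝒱_{n+1}) ⊆ π₂⁻¹(𝒱_n) for 𝒱_n = 𝔜_rig[0, 1 − e^(1−n)/(e+1)] established in the proof of Proposition 3.2 of the paper, stated in the abstract setting of the measures of singularity.) -/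
/-- The covering inclusion `π₁⁻¹(𝒱_{n+1}) ⊆ π₂⁻¹(𝒱_n)` from the proof of
Proposition 3.2 of the paper, in the abstract setting: for every `n ≥ 0` and
`Q ∈ Y⁰`, if `ν_Y (π₁ Q) ≤ 1 - e^(-n)/(e+1)` then
`ν_Y (π₂ Q) ≤ 1 - e^(1-n)/(e+1)`. -/
theorem covering_inclusion
    (X Y Y0 : Type*) (π : Y → X) (w : Y → Y) (νY : Y → ℝ) (νX : X → ℝ)
    (e : ℝ) (he : 1 < e)
    (hbound : ∀ Q : Y, 0 ≤ νY Q ∧ νY Q ≤ 1)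
    (hcan : ∀ Q : Y, νY Q < e / (e + 1) → νX (π Q) = νY Q)
    (hanti : ∀ Q : Y, e / (e + 1) < νY Q → νX (π Q) = e * (1 - νY Q))
    (hsing : ∀ Q : Y, νY Q = e / (e + 1) → e / (e + 1) ≤ νX (π Q))
    (hw : ∀ Q : Y, νY (w Q) = 1 - νY Q)
    (π₁ π₁' π₂ : Y0 → Y)
    (hcompat : ∀ Q : Y0, π (π₁ Q) = π (π₁' Q))
    (hπ₂ : ∀ Q : Y0, π₂ Q = w (π₁' Q))
    (hA5 : ∀ Q : Y0,
      (νY (π₁ Q) < e / (e + 1) → e / (e + 1) < νY (π₁' Q)) ∧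
      (νY (π₁' Q) < e / (e + 1) → e / (e + 1) < νY (π₁ Q))) :
    ∀ n : ℕ, ∀ Q : Y0,
      νY (π₁ Q) ≤ 1 - e ^ (-(n : ℝ)) / (e + 1) →
      νY (π₂ Q) ≤ 1 - e ^ (1 - (n : ℝ)) / (e + 1) := by
  intro n Q h
  have he0 : 0 < e := by linarith
  have ht : e ^ (1 - (n : ℝ)) = e * e ^ (-(n : ℝ)) := by
    rw [sub_eq_add_neg, Real.rpow_add he0, Real.rpow_one]
  have ht1 : e ^ (-(n : ℝ)) ≤ 1 :=
    Real.rpow_le_one_of_one_le_of_nonpos he.le (by simp)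
  rw [hπ₂, hw, ht, mul_div_assoc]
  have key : e * (e ^ (-(n : ℝ)) / (e + 1)) ≤ νY (π₁' Q) := by
    by_cases hb : νY (π₁' Q) < e / (e + 1)
    · have ha := (hA5 Q).2 hb
      rw [← hcan _ hb, ← hcompat, hanti _ ha]
      exact mul_le_mul_of_nonneg_left (by linarith) he0.le
    · refine le_trans ?_ (not_lt.mp hb)
      rw [← mul_div_assoc]
      exact div_le_div_of_nonneg_right (by nlinarith) (by linarith)
  linarith
end

section
/- Let e > 1, q ≥ 1, K ≥ 0, and M ≥ 0 be real numbers, and let (a_n)_{n≥0} be a sequence of nonnegative real numbers such that a₀ ≤ M and a_{n+1} ≤ max(M, q^(K·e^(−n))·a_n) for all n ≥ 0. Then a_n ≤ M·q^(K·e/(e−1)) for all n ≥ 0. (The inductive norm estimate carried out in the proof of Lemma 4.7 of the paper, which bounds an overconvergent section f on the region 𝒱[1−r,1) by combining the boundedness of f − b·f^τ with the recursive bound |f^τ| ≤ q^(k·r·e^(−n))·M_n on successive annuli; here K plays the role of k·r and a_n the sup-norm of f on the n-th annulus.) -/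
/-- The inductive norm estimate from the proof of Lemma 4.7 of the paper: if
`e > 1`, `q ≥ 1`, `K ≥ 0`, `M ≥ 0` and `(a_n)` is a sequence of nonnegative
reals with `a 0 ≤ M` and `a (n+1) ≤ max M (q^(K·e^(-n))·a n)` for all `n`,
then `a n ≤ M·q^(K·e/(e-1))` for all `n`. -/
theorem inductive_norm_estimate
    (e q K M : ℝ) (he : 1 < e) (hq : 1 ≤ q) (hK : 0 ≤ K) (hM : 0 ≤ M)
    (a : ℕ → ℝ) (ha : ∀ n : ℕ, 0 ≤ a n) (ha0 : a 0 ≤ M)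
    (hrec : ∀ n : ℕ, a (n + 1) ≤ max M (q ^ (K * e ^ (-(n : ℝ))) * a n)) :
    ∀ n : ℕ, a n ≤ M * q ^ (K * e / (e - 1)) := by
  have hq0 : 0 < q := by linarith
  have he0 : 0 < e := by linarith
  have he1 : 0 < e - 1 := by linarith
  have hC : 0 ≤ K * e / (e - 1) := by positivity
  have hle : ∀ n : ℕ, e ^ (-(n : ℝ)) ≤ 1 := fun n =>
    Real.rpow_le_one_of_one_le_of_nonpos he.le (by simp)
  have hpos : ∀ n : ℕ, 0 < e ^ (-(n : ℝ)) := fun n => Real.rpow_pos_of_pos he0 _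
  have key : ∀ n : ℕ, a n ≤ M * q ^ (K * e / (e - 1) * (1 - e ^ (-(n : ℝ)))) := by
    intro n
    induction n with
    | zero => simpa using ha0
    | succ n ih =>
      refine (hrec n).trans (max_le ?_ ?_)
      · exact le_mul_of_one_le_right hM
          (Real.one_le_rpow hq (mul_nonneg hC (sub_nonneg.2 (hle (n + 1)))))
      · have hs : e ^ (-((n + 1 : ℕ) : ℝ)) = e ^ (-(n : ℝ)) / e := by
          rw [← Real.rpow_sub_one he0.ne']
          congr 1
          push_cast
          ring
        have hx : K * e / (e - 1) * (1 - e ^ (-((n + 1 : ℕ) : ℝ))) =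
            K * e ^ (-(n : ℝ)) + K * e / (e - 1) * (1 - e ^ (-(n : ℝ))) := by
          rw [hs]
          generalize e ^ (-(n : ℝ)) = x
          have := he1.ne'
          field_simp
          ring
        rw [hx, Real.rpow_add hq0]
        calc _ ≤ q ^ (K * e ^ (-(n : ℝ))) *
              (M * q ^ (K * e / (e - 1) * (1 - e ^ (-(n : ℝ))))) :=
              mul_le_mul_of_nonneg_left ih (Real.rpow_nonneg hq0.le _)
          _ = _ := by ring
  intro n
  refine (key n).trans (mul_le_mul_of_nonneg_left
    (Real.rpow_le_rpow_of_exponent_le hq ?_) hM)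
  exact mul_le_of_le_one_right hC (by linarith [hpos n])
end

section
/- Let e > 1, q ≥ 1, k ≥ 0, r ≥ 0, and M′ ≥ 0 be real numbers. Let S be a set, τ : S → S a map, and μ : S → ℝ a nonnegative function with μ(τ(s)) = e·μ(s) for all s ∈ S. Let (g_n)_{n≥0} be a sequence of nonnegative functions on S such that g_n(s) ≤ q^(k·μ(s))·g_{n−1}(τ(s)) for all n ≥ 1 and all s ∈ S, and such that g₀(s) ≤ M′ whenever μ(s) ≤ r·e. Then for every n ≥ 0 and every s ∈ S with μ(s) ≤ r·e^(1−n), one has g_n(s) ≤ M′·q^(k·r·e/(e−1)). (The uniform bound of Lemma 4.8 of the paper: |f^{τⁿ}| is uniformly bounded on the regions 𝒱 I_n; here μ(s) plays the role of ν_X(π(φ₁(Q))), the multiplicativity μ(τ s) = e·μ(s) is the relation ν_X(P_j) = e^j·ν_X(P₀) of Remark 4.4, g_n the pointwise norm |f^{τⁿ}(·)|, and the hypothesis on g_n is the norm inequality of Proposition 4.5.) -/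
/-- The uniform bound of Lemma 4.8 of the paper, in abstract form: with
`μ (τ s) = e·μ s`, `g n s ≤ q^(k·μ s)·g (n-1) (τ s)` and `g 0 ≤ M′` on
`{μ ≤ r·e}`, one has `g n s ≤ M′·q^(k·r·e/(e-1))` whenever
`μ s ≤ r·e^(1-n)`. -/
theorem uniform_bound
    (e q k r M' : ℝ) (he : 1 < e) (hq : 1 ≤ q) (hk : 0 ≤ k) (hr : 0 ≤ r)
    (hM' : 0 ≤ M')
    (S : Type*) (τ : S → S) (μ : S → ℝ)
    (hμ : ∀ s : S, 0 ≤ μ s) (hμτ : ∀ s : S, μ (τ s) = e * μ s)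
    (g : ℕ → S → ℝ) (hg : ∀ (n : ℕ) (s : S), 0 ≤ g n s)
    (hrec : ∀ (n : ℕ) (s : S), g (n + 1) s ≤ q ^ (k * μ s) * g n (τ s))
    (hbase : ∀ s : S, μ s ≤ r * e → g 0 s ≤ M') :
    ∀ (n : ℕ) (s : S), μ s ≤ r * e ^ (1 - (n : ℝ)) →
      g n s ≤ M' * q ^ (k * r * e / (e - 1)) := by
  have he0 : 0 < e := by linarith
  have he1 : 0 < e - 1 := by linarith
  have hq0 : 0 < q := by linarith
  have key : ∀ (n : ℕ) (s : S), μ s ≤ r * e ^ (1 - (n : ℝ)) →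
      g n s ≤ M' * q ^ (k * (r * e - μ s) / (e - 1)) := by
    intro n
    induction n with
    | zero =>
      intro s hs
      have hs' : μ s ≤ r * e := by simpa using hs
      have h1 : 0 ≤ k * (r * e - μ s) / (e - 1) :=
        div_nonneg (mul_nonneg hk (by linarith)) he1.le
      exact (hbase s hs').trans
        (le_mul_of_one_le_right hM' (Real.one_le_rpow hq h1))
    | succ n ih =>
      intro s hs
      have h2 : e * e ^ (1 - ((n + 1 : ℕ) : ℝ)) = e ^ (1 - (n : ℝ)) := by
        have h3 : (1 - (n : ℝ)) = 1 + (1 - ((n + 1 : ℕ) : ℝ)) := by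
          push_cast
          ring
        rw [h3, Real.rpow_add he0, Real.rpow_one]
      have h4 : μ (τ s) ≤ r * e ^ (1 - (n : ℝ)) := by
        rw [hμτ, ← h2]
        have := mul_le_mul_of_nonneg_left hs he0.le
        linarith
      have h5 := ih (τ s) h4
      rw [hμτ] at h5
      have h6 : k * (r * e - μ s) / (e - 1)
          = k * μ s + k * (r * e - e * μ s) / (e - 1) := by
        field_simp
        ring
      rw [h6, Real.rpow_add hq0]
      have h7 := mul_le_mul_of_nonneg_left h5 (Real.rpow_nonneg hq0.le (k * μ s))
      have h8 := hrec n s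
      linarith
  intro n s hs
  refine (key n s hs).trans (mul_le_mul_of_nonneg_left ?_ hM')
  apply Real.rpow_le_rpow_of_exponent_le hq
  apply div_le_div_of_nonneg_right _ he1.le
  have := mul_nonneg hk (hμ s)
  linarith
end
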